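/- Let d := log 2 / log 3. The Cantor set K is Ahlfors d-regular: there exists a constant C ≥ 1 such that C^{−1} r^d ≤ ℋ^d(B(x,r) ∩ K) ≤ C r^d for every x ∈ K and every 0 < r ≤ 1. In particular 0 < ℋ^d(K) < ∞. -/

import Mathlib

open MeasureTheory Filter Set Metric
open scoped ENNReal Topology

noncomputable section

/-- The map `π : Σ = {0,1}^ℕ → ℝ` (with `false` representing the digit 0 and `true`
representing the digit 1, coordinates indexed from 0), `π(a) = ∑_{i} 2 aᵢ 3^{-(i+1)}`. -/
def cantorPi (a : ℕ → Bool) : ℝ := ∑' i : ℕ, (if a i then 2 else 0) / 3 ^ (i + 1)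

/-- The middle-third Cantor set `K = π(Σ)`. -/
def cantorK : Set ℝ := Set.range cantorPi

/-- The similar copy `K_a` of `K` determined by a finite binary string `a` of length `N`. -/
def cantorCyl {N : ℕ} (a : Fin N → Bool) : Set ℝ :=
  cantorPi '' {b : ℕ → Bool | ∀ i : Fin N, b i = a i}

/-- The number of zeros in the finite binary string `a`. -/
def zeros {N : ℕ} (a : Fin N → Bool) : ℕ := (Finset.univ.filter fun i => a i = false).card

/-- One step of the Bernoulli(w) shift map on `[0,1)`. -/
def bernStep (w x : ℝ) : ℝ := if x < w then x / w else (x - w) / (1 - w)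

/-- The Bernoulli(w) digit sequence of `x ∈ [0,1)`: digit `n` is `false` (i.e. 0)
iff the `n`-th iterate of the Bernoulli shift lies in `[0,w)`. -/
def bernDigits (w x : ℝ) : ℕ → Bool := fun n => decide (w ≤ (bernStep w)^[n] x)

/-- The Bernoulli product probability measure `ν_{w,Σ}` on `Σ = {0,1}^ℕ`, under which the
coordinates are i.i.d. with mass `w` on 0 (= `false`) and mass `1-w` on 1 (= `true`);
realized as the law of the Bernoulli(w) digit sequence of a uniform point of `[0,1)`. -/
def bernMeasure (w : ℝ) : Measure (ℕ → Bool) :=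
  Measure.map (bernDigits w) (volume.restrict (Set.Ico (0:ℝ) 1))

/-- The measure `ν_w = π_* ν_{w,Σ}` on `ℝ`, concentrated on `K`. -/
def nu (w : ℝ) : Measure ℝ := (bernMeasure w).map cantorPi

open scoped NNReal Pointwise

theorem cantorPi_eq_ofDigits (a : ℕ → Bool) :
    cantorPi a = Real.ofDigits (fun i ↦ cond (a i) (2 : Fin 3) 0) := by
  refine tsum_congr fun i ↦ ?_
  cases h : a i <;> simp [Real.ofDigitsTerm, h, div_eq_mul_inv]

theorem abs_cantorPi_sub_le {a b : ℕ → Bool} {n : ℕ} (h : ∀ i < n, a i = b i) :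
    |cantorPi a - cantorPi b| ≤ ((3 : ℝ) ^ n)⁻¹ := by
  rw [cantorPi_eq_ofDigits, cantorPi_eq_ofDigits]
  exact Real.abs_ofDigits_sub_ofDigits_le fun i hi ↦ by rw [h i hi]

/-- The self-similarity of `cantorPi`: on the sequences that start with the same `n` digits,
it is an affine function of `cantorPi` of the shifted sequence. -/
theorem cantorPi_eq_add_shift (a : ℕ → Bool) (n : ℕ) :
    cantorPi a = (∑ i ∈ Finset.range n, (if a i then 2 else 0) / 3 ^ (i + 1)) +
      ((3 : ℝ) ^ n)⁻¹ * cantorPi (fun i ↦ a (i + n)) := by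
  simp only [cantorPi_eq_ofDigits]
  rw [Real.ofDigits_eq_sum_add_ofDigits _ n]
  congr 1
  refine Finset.sum_congr rfl fun i _ ↦ ?_
  cases h : a i <;> simp [Real.ofDigitsTerm, h, div_eq_mul_inv]

theorem cantorPi_mem_Icc (a : ℕ → Bool) : cantorPi a ∈ Icc (0 : ℝ) 1 := by
  rw [cantorPi_eq_ofDigits]
  exact ⟨Real.ofDigits_nonneg _, Real.ofDigits_le_one _⟩

theorem le_abs_cantorPi_sub {a b : ℕ → Bool} {n : ℕ} (h : ∀ i < n, a i = b i)
    (hn : a n ≠ b n) : ((3 : ℝ) ^ (n + 1))⁻¹ ≤ |cantorPi a - cantorPi b| := by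
  have hsum : ∑ i ∈ Finset.range n, (if a i then (2 : ℝ) else 0) / 3 ^ (i + 1) =
      ∑ i ∈ Finset.range n, (if b i then (2 : ℝ) else 0) / 3 ^ (i + 1) :=
    Finset.sum_congr rfl fun i hi ↦ by rw [h i (Finset.mem_range.1 hi)]
  have ha := cantorPi_mem_Icc fun i ↦ a (i + (n + 1))
  have hb := cantorPi_mem_Icc fun i ↦ b (i + (n + 1))
  have hpos : (0 : ℝ) < ((3 : ℝ) ^ (n + 1))⁻¹ := by positivity
  rw [cantorPi_eq_add_shift a (n + 1), cantorPi_eq_add_shift b (n + 1), Finset.sum_range_succ,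
    Finset.sum_range_succ, hsum, le_abs]
  simp only [div_eq_mul_inv]
  generalize ((3 : ℝ) ^ (n + 1))⁻¹ = t at *
  cases h₁ : a n <;> cases h₂ : b n
  · simp_all
  · right
    simp only [Bool.false_eq_true, if_true, if_false]
    nlinarith [ha.1, ha.2, hb.1, hb.2]
  · left
    simp only [Bool.false_eq_true, if_true, if_false]
    nlinarith [ha.1, ha.2, hb.1, hb.2]
  · simp_all

theorem cantorPi_injective : Function.Injective cantorPi := by
  intro a b hab
  by_contra hne
  have h := le_abs_cantorPi_sub (fun i hi ↦ PiNat.apply_eq_of_lt_firstDiff hi)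
    (PiNat.apply_firstDiff_ne hne)
  rw [hab, sub_self, abs_zero] at h
  exact absurd h (not_le.2 (by positivity))

theorem inv_three_pow_rpow_logb (n : ℕ) :
    (((3 : ℝ) ^ n)⁻¹) ^ Real.logb 3 2 = ((2 : ℝ) ^ n)⁻¹ := by
  rw [Real.inv_rpow (by positivity), ← Real.rpow_natCast_mul (by norm_num), mul_comm,
    Real.rpow_mul_natCast (by norm_num), Real.rpow_logb] <;> norm_num

theorem logb_three_two_pos : 0 < Real.logb 3 2 :=
  Real.logb_pos (by norm_num) (by norm_num)

theorem hausdorffMeasure_cantorK_le_one : μH[Real.logb 3 2] cantorK ≤ 1 := by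
  have hdiam (n : ℕ) (w : Fin n → Bool) :
      ediam (cantorCyl w) ≤ ENNReal.ofReal ((3 : ℝ) ^ n)⁻¹ := by
    refine ediam_le ?_
    rintro _ ⟨a, ha, rfl⟩ _ ⟨b, hb, rfl⟩
    rw [edist_dist, Real.dist_eq]
    exact ENNReal.ofReal_le_ofReal
      (abs_cantorPi_sub_le fun i hi ↦ (ha ⟨i, hi⟩).trans (hb ⟨i, hi⟩).symm)
  have hr : Tendsto (fun n : ℕ ↦ ENNReal.ofReal ((3 : ℝ) ^ n)⁻¹) atTop (𝓝 0) := by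
    rw [← ENNReal.ofReal_zero]
    refine ENNReal.tendsto_ofReal ?_
    exact tendsto_inv_atTop_zero.comp (tendsto_pow_atTop_atTop_of_one_lt (by norm_num))
  refine (Measure.hausdorffMeasure_le_liminf_sum (ι := fun n ↦ Fin n → Bool) _ cantorK _ hr
    (fun n w ↦ cantorCyl w) (.of_forall hdiam) (.of_forall fun n ↦ ?_)).trans ?_
  · rintro _ ⟨a, rfl⟩
    exact mem_iUnion.2 ⟨fun i ↦ a i, a, fun _ ↦ rfl, rfl⟩
  · refine (liminf_le_liminf (v := fun _ ↦ 1) (.of_forall fun n ↦ ?_)).trans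
      (liminf_const _).le
    calc ∑ w : Fin n → Bool, ediam (cantorCyl w) ^ Real.logb 3 2
        ≤ ∑ _w : Fin n → Bool, ENNReal.ofReal ((2 : ℝ) ^ n)⁻¹ := by
          refine Finset.sum_le_sum fun w _ ↦ ?_
          rw [← inv_three_pow_rpow_logb,
            ← ENNReal.ofReal_rpow_of_pos (by positivity)]
          exact ENNReal.rpow_le_rpow (hdiam n w) logb_three_two_pos.le
      _ = 1 := by
          rw [Finset.sum_const, Finset.card_univ, Fintype.card_fun, Fintype.card_bool,
            Fintype.card_fin, ← ENNReal.ofReal_nsmul, nsmul_eq_mul, Nat.cast_pow, Nat.cast_ofNat,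
            mul_inv_cancel₀ (by positivity), ENNReal.ofReal_one]

/-- The Cantor function: it reads the ternary digits `0` and `2` of a point of the Cantor set as
the binary digits `0` and `1`. -/
def cantorFunction (x : ℝ) : ℝ :=
  Real.ofDigits fun i ↦ cond (Function.invFun cantorPi x i) (1 : Fin 2) 0

theorem cantorFunction_cantorPi (a : ℕ → Bool) :
    cantorFunction (cantorPi a) = Real.ofDigits fun i ↦ cond (a i) (1 : Fin 2) 0 := by
  rw [cantorFunction, Function.leftInverse_invFun cantorPi_injective a]

theorem holderOnWith_cantorFunction :
    HolderOnWith 2 (Real.logb 3 2).toNNReal cantorFunction cantorK := by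
  rintro _ ⟨a, rfl⟩ _ ⟨b, rfl⟩
  obtain rfl | hne := eq_or_ne a b
  · simp
  have hagree : ∀ i < PiNat.firstDiff a b, a i = b i := fun i hi ↦
    PiNat.apply_eq_of_lt_firstDiff hi
  have hlow := le_abs_cantorPi_sub hagree (PiNat.apply_firstDiff_ne hne)
  rw [cantorFunction_cantorPi, cantorFunction_cantorPi, edist_dist, edist_dist, Real.dist_eq,
    Real.dist_eq, Real.coe_toNNReal _ logb_three_two_pos.le,
    ENNReal.ofReal_rpow_of_nonneg (abs_nonneg _) logb_three_two_pos.le,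
    show ((2 : ℝ≥0) : ℝ≥0∞) = ENNReal.ofReal 2 by simp,
    ← ENNReal.ofReal_mul (by norm_num)]
  refine ENNReal.ofReal_le_ofReal ?_
  calc _ ≤ (((2 : ℕ) : ℝ) ^ PiNat.firstDiff a b)⁻¹ :=
        Real.abs_ofDigits_sub_ofDigits_le fun i hi ↦ by rw [hagree i hi]
    _ = 2 * (((3 : ℝ) ^ (PiNat.firstDiff a b + 1))⁻¹) ^ Real.logb 3 2 := by
        rw [inv_three_pow_rpow_logb, pow_succ]
        push_cast
        field_simp
    _ ≤ _ := by
        gcongr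
        exact logb_three_two_pos.le

theorem Icc_subset_cantorFunction_image : Icc 0 1 ⊆ cantorFunction '' cantorK := by
  intro y hy
  obtain ⟨c, -, rfl⟩ := Real.ofDigits_SurjOn (b := 2) (by norm_num) hy
  refine ⟨_, ⟨fun i ↦ decide (c i = 1), rfl⟩, ?_⟩
  rw [cantorFunction_cantorPi]
  congr 1
  funext i
  generalize c i = k
  fin_cases k <;> rfl

theorem inv_two_le_hausdorffMeasure_cantorK : 2⁻¹ ≤ μH[Real.logb 3 2] cantorK := by
  have h := holderOnWith_cantorFunction.hausdorffMeasure_image_le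
    (Real.toNNReal_pos.2 logb_three_two_pos) zero_le_one
  rw [mul_one, Real.coe_toNNReal _ logb_three_two_pos.le, ENNReal.rpow_one,
    hausdorffMeasure_real] at h
  have h₁ : (1 : ℝ≥0∞) ≤ volume (cantorFunction '' cantorK) := by
    simpa using measure_mono (μ := volume) Icc_subset_cantorFunction_image
  rw [ENNReal.inv_le_iff_le_mul (by simp) (by simp)]
  simpa using h₁.trans h

theorem cantorPi_image_cylinder (a : ℕ → Bool) (n : ℕ) :
    cantorPi '' PiNat.cylinder a n =
      (∑ i ∈ Finset.range n, (if a i then (2 : ℝ) else 0) / 3 ^ (i + 1)) +ᵥ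
        (((3 : ℝ) ^ n)⁻¹ • cantorK) := by
  ext x
  simp only [mem_vadd_set, mem_smul_set, vadd_eq_add, smul_eq_mul]
  constructor
  · rintro ⟨b, hb, rfl⟩
    refine ⟨_, ⟨_, ⟨fun i ↦ b (i + n), rfl⟩, rfl⟩, ?_⟩
    rw [cantorPi_eq_add_shift b n]
    congr 1
    exact Finset.sum_congr rfl fun i hi ↦ by rw [hb i (Finset.mem_range.1 hi)]
  · rintro ⟨_, ⟨_, ⟨c, rfl⟩, rfl⟩, rfl⟩
    refine ⟨fun i ↦ if i < n then a i else c (i - n), fun i hi ↦ if_pos hi, ?_⟩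
    rw [cantorPi_eq_add_shift _ n]
    congr 1
    · exact Finset.sum_congr rfl fun i hi ↦ by rw [if_pos (Finset.mem_range.1 hi)]
    · simp

theorem hausdorffMeasure_cantorPi_image_cylinder (a : ℕ → Bool) (n : ℕ) :
    μH[Real.logb 3 2] (cantorPi '' PiNat.cylinder a n) =
      ENNReal.ofReal ((2 : ℝ) ^ n)⁻¹ * μH[Real.logb 3 2] cantorK := by
  rw [cantorPi_image_cylinder, hausdorffMeasure_vadd _ (.inl logb_three_two_pos.le),
    Measure.hausdorffMeasure_smul₀ logb_three_two_pos.le (by positivity), ENNReal.smul_def,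
    smul_eq_mul, ← inv_three_pow_rpow_logb]
  congr 1
  rw [ENNReal.coe_rpow_of_nonneg _ logb_three_two_pos.le, ← enorm_eq_nnnorm,
    Real.enorm_of_nonneg (by positivity),
    ENNReal.ofReal_rpow_of_nonneg (by positivity) logb_three_two_pos.le]

theorem ball_inter_cantorK_subset (a : ℕ → Bool) {n : ℕ} {r : ℝ} (hr : r ≤ ((3 : ℝ) ^ n)⁻¹) :
    ball (cantorPi a) r ∩ cantorK ⊆ cantorPi '' PiNat.cylinder a n := by
  rintro _ ⟨hx, b, rfl⟩
  refine ⟨b, ?_, rfl⟩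
  obtain rfl | hne := eq_or_ne b a
  · exact PiNat.self_mem_cylinder _ _
  rw [PiNat.mem_cylinder_iff_le_firstDiff hne]
  by_contra! hlt
  have hlow := le_abs_cantorPi_sub (fun i hi ↦ PiNat.apply_eq_of_lt_firstDiff hi)
    (PiNat.apply_firstDiff_ne hne)
  rw [mem_ball, Real.dist_eq] at hx
  have : ((3 : ℝ) ^ n)⁻¹ ≤ ((3 : ℝ) ^ (PiNat.firstDiff b a + 1))⁻¹ := by
    gcongr
    · norm_num
    · exact hlt
  linarith

theorem cantorPi_image_cylinder_subset (a : ℕ → Bool) {n : ℕ} {r : ℝ}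
    (hr : ((3 : ℝ) ^ n)⁻¹ < r) :
    cantorPi '' PiNat.cylinder a n ⊆ ball (cantorPi a) r ∩ cantorK := by
  rintro _ ⟨b, hb, rfl⟩
  refine ⟨?_, b, rfl⟩
  rw [mem_ball, Real.dist_eq]
  exact (abs_cantorPi_sub_le hb).trans_lt hr

/-- With `d := log 2 / log 3`, the Cantor set `K` is Ahlfors `d`-regular: there is `C ≥ 1`
with `C⁻¹ r^d ≤ ℋ^d(B(x,r) ∩ K) ≤ C r^d` for every `x ∈ K` and every `0 < r ≤ 1`.
In particular `0 < ℋ^d(K) < ∞`. -/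
theorem cantorK_ahlforsRegular :
    (∃ C : ℝ, 1 ≤ C ∧ ∀ x ∈ cantorK, ∀ r : ℝ, 0 < r → r ≤ 1 →
      ENNReal.ofReal (C⁻¹ * r ^ (Real.log 2 / Real.log 3)) ≤
          μH[Real.log 2 / Real.log 3] (Metric.ball x r ∩ cantorK) ∧
        μH[Real.log 2 / Real.log 3] (Metric.ball x r ∩ cantorK) ≤
          ENNReal.ofReal (C * r ^ (Real.log 2 / Real.log 3))) ∧
      0 < μH[Real.log 2 / Real.log 3] cantorK ∧
        μH[Real.log 2 / Real.log 3] cantorK < ⊤ := by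
  simp only [Real.log_div_log]
  refine ⟨⟨4, by norm_num, ?_⟩,
    (ENNReal.inv_pos.2 ENNReal.ofNat_ne_top).trans_le inv_two_le_hausdorffMeasure_cantorK,
    hausdorffMeasure_cantorK_le_one.trans_lt ENNReal.one_lt_top⟩
  rintro _ ⟨a, rfl⟩ r hr hr1
  obtain ⟨n, hn, hn'⟩ :=
    exists_nat_pow_near_of_lt_one hr hr1 (y := (3 : ℝ)⁻¹) (by norm_num) (by norm_num)
  rw [inv_pow] at hn hn'
  have hle := Real.rpow_le_rpow hr.le hn' logb_three_two_pos.le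
  have hge := Real.rpow_le_rpow (by positivity) hn.le logb_three_two_pos.le
  rw [inv_three_pow_rpow_logb] at hle hge
  have hpow : ((2 : ℝ) ^ (n + 1))⁻¹ = ((2 : ℝ) ^ n)⁻¹ * 2⁻¹ := by rw [pow_succ, mul_inv]
  constructor
  · calc ENNReal.ofReal (4⁻¹ * r ^ Real.logb 3 2)
        ≤ ENNReal.ofReal (((2 : ℝ) ^ (n + 1))⁻¹ * 2⁻¹) :=
          ENNReal.ofReal_le_ofReal (by linarith)
      _ = ENNReal.ofReal ((2 : ℝ) ^ (n + 1))⁻¹ * 2⁻¹ := by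
          rw [ENNReal.ofReal_mul (by positivity), ENNReal.ofReal_inv_of_pos two_pos,
            ENNReal.ofReal_ofNat]
      _ ≤ ENNReal.ofReal ((2 : ℝ) ^ (n + 1))⁻¹ * μH[Real.logb 3 2] cantorK := by
          gcongr
          exact inv_two_le_hausdorffMeasure_cantorK
      _ = μH[Real.logb 3 2] (cantorPi '' PiNat.cylinder a (n + 1)) :=
          (hausdorffMeasure_cantorPi_image_cylinder a (n + 1)).symm
      _ ≤ _ := measure_mono (cantorPi_image_cylinder_subset a hn)
  · calc _ ≤ μH[Real.logb 3 2] (cantorPi '' PiNat.cylinder a n) :=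
          measure_mono (ball_inter_cantorK_subset a hn')
      _ = ENNReal.ofReal ((2 : ℝ) ^ n)⁻¹ * μH[Real.logb 3 2] cantorK :=
          hausdorffMeasure_cantorPi_image_cylinder a n
      _ ≤ ENNReal.ofReal ((2 : ℝ) ^ n)⁻¹ :=
          mul_le_of_le_one_right' hausdorffMeasure_cantorK_le_one
      _ ≤ ENNReal.ofReal (4 * r ^ Real.logb 3 2) :=
          ENNReal.ofReal_le_ofReal (by linarith [Real.rpow_nonneg hr.le (Real.logb 3 2)])
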